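/- arXiv:math/0303068 — 2 statements merged into one kernel-verified Lean document; each statement's English description precedes it below -/
import Mathlib

section
/- Under the standing assumptions, for all p,q ≥ 0 and all 0 ≤ i ≤ p−2, the horizontal face operators on H^{⊗(p+1)}⊗A^{⊗(q+1)} satisfy d_i ∘ d_{i+1} = d_i ∘ d_i, where d_i(g_0,…,g_p | a_0,…,a_q) = (g_0,…,g_i⁽¹⁾g_{i+1}⁽¹⁾,…,g_p | σ(g_i⁽²⁾,g_{i+1}⁽²⁾)a_0, a_1,…,a_q) for 0 ≤ i < p. -/
open TensorProduct

noncomputable section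

/-! ## Tensor powers, iterated comultiplication and Sweedler representations -/

/-- `Tpow k V n` is the `(n+1)`-fold tensor power `V ⊗ V ⊗ ⋯ ⊗ V` (`n+1` factors),
bundled as an object of `ModuleCat k`. -/
def Tpow (k : Type) [Field k] (V : Type) [AddCommGroup V] [Module k V] : ℕ → ModuleCat k
  | 0 => ModuleCat.of k V
  | n + 1 => ModuleCat.of k (V ⊗[k] (Tpow k V n))

/-- The elementary tensor `f 0 ⊗ f 1 ⊗ ⋯ ⊗ f n` in `Tpow k V n`. -/
def tpow (k : Type) [Field k] (V : Type) [AddCommGroup V] [Module k V] :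
    (n : ℕ) → (Fin (n + 1) → V) → Tpow k V n
  | 0, f => (f 0 : V)
  | n + 1, f => (f 0 ⊗ₜ[k] tpow k V n (fun i => f i.succ) : V ⊗[k] Tpow k V n)

/-- The iterated comultiplication `Δ⁽ⁿ⁾ : H → H^{⊗(n+1)}`, `Δ⁽⁰⁾ = id`,
`Δ⁽ⁿ⁺¹⁾ = (1 ⊗ Δ⁽ⁿ⁾) ∘ Δ`. -/
def comulIter (k : Type) [Field k] (H : Type) [Ring H] [HopfAlgebra k H] :
    (n : ℕ) → H →ₗ[k] Tpow k H n
  | 0 => LinearMap.id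
  | n + 1 =>
    (LinearMap.lTensor H (comulIter k H n) ∘ₗ Coalgebra.comul :
      H →ₗ[k] (H ⊗[k] Tpow k H n))

/-- A finite Sweedler-type representation `Δ⁽ⁿ⁾ h = ∑ᵢ h⁽¹⁾ᵢ ⊗ ⋯ ⊗ h⁽ⁿ⁺¹⁾ᵢ` of the iterated
comultiplication of `h`; `leg i j` is the `(j+1)`-st Sweedler leg of the `i`-th summand. -/
structure IterRepr (k : Type) [Field k] (H : Type) [Ring H] [HopfAlgebra k H]
    (n : ℕ) (h : H) where
  ι : Type
  s : Finset ι
  leg : ι → Fin (n + 1) → H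
  eq : ∑ i ∈ s, tpow k H n (leg i) = comulIter k H n h

/-- Merge an `(n+1)`-tuple to an `n`-tuple, replacing the two entries at positions `i, i+1`
by the single entry `v`. -/
def mergeAt {V : Type} {n : ℕ} (i : Fin n) (x : Fin (n + 1) → V) (v : V) :
    Fin n → V :=
  fun j => if (j : ℕ) < (i : ℕ) then x (Fin.castSucc j) else
    if (j : ℕ) = (i : ℕ) then v else x j.succ

variable (k : Type) [Field k] (H : Type) [Ring H] [HopfAlgebra k H]

/-- `H` is cocommutative. -/
def Cocomm : Prop :=
  ∀ h : H, (TensorProduct.comm k H H) (Coalgebra.comul (R := k) h) = Coalgebra.comul (R := k) h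

variable (A : Type) [Ring A] [Algebra k A]
variable (rho : H →ₗ[k] A →ₗ[k] A)

/-- `rho` is a weak action of `H` on `A`:
`h(ab) = h⁽¹⁾(a)h⁽²⁾(b)`, `h(1) = ε(h)1` and `1(a) = a`. -/
def IsWeakAction : Prop :=
  (∀ (h : H) (a b : A) (R : IterRepr k H 1 h),
      rho h (a * b) = ∑ i ∈ R.s, rho (R.leg i 0) a * rho (R.leg i 1) b) ∧
  (∀ h : H, rho h (1 : A) = Coalgebra.counit (R := k) h • (1 : A)) ∧
  (∀ a : A, rho 1 a = a)

/-- `rho` makes `A` a left `H`-module algebra: a weak action which is an action. -/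
def IsModuleAlgebraAction : Prop :=
  IsWeakAction k H A rho ∧ (∀ (h l : H) (a : A), rho (h * l) a = rho h (rho l a))

variable (sg : H →ₗ[k] H →ₗ[k] k)

/-- Normality for a `k`-valued cocycle: `σ(h,1) = σ(1,h) = ε(h)`. -/
def NormalK : Prop :=
  ∀ h : H, sg h 1 = Coalgebra.counit (R := k) h ∧ sg 1 h = Coalgebra.counit (R := k) h

/-- The cocycle property for a `k`-valued cocycle:
`σ(l⁽¹⁾,m⁽¹⁾)σ(h,l⁽²⁾m⁽²⁾) = σ(h⁽¹⁾,l⁽¹⁾)σ(h⁽²⁾l⁽²⁾,m)`. -/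
def CocycleK : Prop :=
  ∀ (h l m : H) (Rh : IterRepr k H 1 h) (Rl : IterRepr k H 1 l) (Rm : IterRepr k H 1 m),
    ∑ j ∈ Rl.s, ∑ c ∈ Rm.s,
        sg (Rl.leg j 0) (Rm.leg c 0) * sg h (Rl.leg j 1 * Rm.leg c 1) =
      ∑ i ∈ Rh.s, ∑ j ∈ Rl.s,
        sg (Rh.leg i 0) (Rl.leg j 0) * sg (Rh.leg i 1 * Rl.leg j 1) m

/-- The twisted module property for a `k`-valued cocycle:
`h⁽¹⁾(l⁽¹⁾(a))σ(h⁽²⁾,l⁽²⁾) = σ(h⁽¹⁾,l⁽¹⁾)(h⁽²⁾l⁽²⁾)(a)`. -/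
def TwistedModuleK : Prop :=
  ∀ (h l : H) (a : A) (Rh : IterRepr k H 1 h) (Rl : IterRepr k H 1 l),
    ∑ i ∈ Rh.s, ∑ j ∈ Rl.s,
        sg (Rh.leg i 1) (Rl.leg j 1) • rho (Rh.leg i 0) (rho (Rl.leg j 0) a) =
      ∑ i ∈ Rh.s, ∑ j ∈ Rl.s,
        sg (Rh.leg i 0) (Rl.leg j 0) • rho (Rh.leg i 1 * Rl.leg j 1) a

/-- The `k`-valued map `σ`, viewed in the convolution algebra `Hom_k(H ⊗ H, A)` via
`x ⊗ y ↦ σ(x,y)1_A`, is convolution invertible. -/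
def ConvInvertibleK : Prop :=
  ∃ sg' : H →ₗ[k] H →ₗ[k] A,
    ∀ (h l : H) (Rh : IterRepr k H 1 h) (Rl : IterRepr k H 1 l),
      (∑ i ∈ Rh.s, ∑ j ∈ Rl.s,
          (sg (Rh.leg i 0) (Rl.leg j 0) • (1 : A)) * sg' (Rh.leg i 1) (Rl.leg j 1) =
        (Coalgebra.counit (R := k) h * Coalgebra.counit (R := k) l) • (1 : A)) ∧
      (∑ i ∈ Rh.s, ∑ j ∈ Rl.s,
          sg' (Rh.leg i 0) (Rl.leg j 0) * (sg (Rh.leg i 1) (Rl.leg j 1) • (1 : A)) =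
        (Coalgebra.counit (R := k) h * Coalgebra.counit (R := k) l) • (1 : A))

/-- Normality, as an identity in `A`: `σ(h,1) = σ(1,h) = ε(h)1_A`. -/
def NormalKA : Prop :=
  ∀ h : H, sg h 1 • (1 : A) = Coalgebra.counit (R := k) h • (1 : A) ∧
    sg 1 h • (1 : A) = Coalgebra.counit (R := k) h • (1 : A)

/-- The cocycle property, as an identity in `A` (values of `σ` lie in `k·1_A`):
`σ(l⁽¹⁾,m⁽¹⁾)σ(h,l⁽²⁾m⁽²⁾) = σ(h⁽¹⁾,l⁽¹⁾)σ(h⁽²⁾l⁽²⁾,m)`. -/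
def CocycleKA : Prop :=
  ∀ (h l m : H) (Rh : IterRepr k H 1 h) (Rl : IterRepr k H 1 l) (Rm : IterRepr k H 1 m),
    ∑ j ∈ Rl.s, ∑ c ∈ Rm.s,
        (sg (Rl.leg j 0) (Rm.leg c 0) * sg h (Rl.leg j 1 * Rm.leg c 1)) • (1 : A) =
      ∑ i ∈ Rh.s, ∑ j ∈ Rl.s,
        (sg (Rh.leg i 0) (Rl.leg j 0) * sg (Rh.leg i 1 * Rl.leg j 1) m) • (1 : A)

/-! ## The operators of the cylindrical module `A ♮_σ H` -/

/-- Spec of the horizontal face `dᵢ` (`0 ≤ i < P`) on `H^{⊗(P+1)} ⊗ A^{⊗(q+1)}`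
(here `P = p+1`):
`dᵢ(g₀,…,g_P | a₀,…,a_q) = (g₀,…,gᵢ⁽¹⁾g_{i+1}⁽¹⁾,…,g_P | σ(gᵢ⁽²⁾,g_{i+1}⁽²⁾)a₀, a₁,…,a_q)`. -/
def IsHorFace (p q : ℕ) (i : Fin (p + 1))
    (D : ((Tpow k H (p + 1) : Type) ⊗[k] (Tpow k A q : Type)) →ₗ[k]
      ((Tpow k H p : Type) ⊗[k] (Tpow k A q : Type))) : Prop :=
  ∀ (g : Fin (p + 2) → H) (a : Fin (q + 1) → A)
    (R : IterRepr k H 1 (g i.castSucc)) (S : IterRepr k H 1 (g i.succ)),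
    D (tpow k H (p + 1) g ⊗ₜ[k] tpow k A q a) =
      ∑ r ∈ R.s, ∑ s ∈ S.s,
        tpow k H p (mergeAt i g (R.leg r 0 * S.leg s 0)) ⊗ₜ[k]
          tpow k A q (Function.update a 0 (sg (R.leg r 1) (S.leg s 1) • a 0))

/-- Spec of the last horizontal face `d_P` on `H^{⊗(P+1)} ⊗ A^{⊗(q+1)}` (here `P = p+1`):
`d_P(g₀,…,g_P | a₀,…,a_q) = (g_P^{(q+2)}g₀⁽¹⁾, g₁,…,g_{P−1} |
σ(g_P^{(q+3)},g₀⁽²⁾)g_P⁽¹⁾(a₀), g_P⁽²⁾(a₁),…,g_P^{(q+1)}(a_q))`. -/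
def IsLastHorFace (p q : ℕ)
    (D : ((Tpow k H (p + 1) : Type) ⊗[k] (Tpow k A q : Type)) →ₗ[k]
      ((Tpow k H p : Type) ⊗[k] (Tpow k A q : Type))) : Prop :=
  ∀ (g : Fin (p + 2) → H) (a : Fin (q + 1) → A)
    (R : IterRepr k H (q + 2) (g (Fin.last (p + 1)))) (S : IterRepr k H 1 (g 0)),
    D (tpow k H (p + 1) g ⊗ₜ[k] tpow k A q a) =
      ∑ r ∈ R.s, ∑ s ∈ S.s,
        tpow k H p
          (Fin.cases (R.leg r ⟨q + 1, by omega⟩ * S.leg s 0)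
            (fun j : Fin p => g j.succ.castSucc)) ⊗ₜ[k]
        tpow k A q (fun c : Fin (q + 1) =>
          if c = 0 then
            sg (R.leg r ⟨q + 2, by omega⟩) (S.leg s 1) • rho (R.leg r 0) (a 0)
          else rho (R.leg r (Fin.castLE (by omega) c)) (a c))

/-- Spec of the horizontal cyclic operator `t` on `H^{⊗(p+1)} ⊗ A^{⊗(q+1)}`:
`t(g₀,…,g_p | a₀,…,a_q) = (g_p^{(q+2)}, g₀,…,g_{p−1} | g_p⁽¹⁾(a₀),…,g_p^{(q+1)}(a_q))`. -/
def IsCycT (p q : ℕ)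
    (T : ((Tpow k H p : Type) ⊗[k] (Tpow k A q : Type)) →ₗ[k]
      ((Tpow k H p : Type) ⊗[k] (Tpow k A q : Type))) : Prop :=
  ∀ (g : Fin (p + 1) → H) (a : Fin (q + 1) → A)
    (R : IterRepr k H (q + 1) (g (Fin.last p))),
    T (tpow k H p g ⊗ₜ[k] tpow k A q a) =
      ∑ r ∈ R.s,
        tpow k H p (Fin.cases (R.leg r (Fin.last (q + 1))) (fun j : Fin p => g j.castSucc))
          ⊗ₜ[k]
        tpow k A q (fun c : Fin (q + 1) => rho (R.leg r c.castSucc) (a c))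

/-- Spec of the vertical cyclic operator `τ` on `H^{⊗(p+1)} ⊗ A^{⊗(q+1)}`:
`τ(g₀,…,g_p | a₀,…,a_q) = (g₀⁽²⁾,…,g_p⁽²⁾ | S(g₀⁽¹⁾⋯g_p⁽¹⁾)(a_q), a₀,…,a_{q−1})`. -/
def IsCycTau (p q : ℕ)
    (T : ((Tpow k H p : Type) ⊗[k] (Tpow k A q : Type)) →ₗ[k]
      ((Tpow k H p : Type) ⊗[k] (Tpow k A q : Type))) : Prop :=
  ∀ (g : Fin (p + 1) → H) (a : Fin (q + 1) → A)
    (R : ∀ i : Fin (p + 1), IterRepr k H 1 (g i)),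
    T (tpow k H p g ⊗ₜ[k] tpow k A q a) =
      ∑ e ∈ Fintype.piFinset (fun i => (R i).s),
        tpow k H p (fun i => (R i).leg (e i) 1) ⊗ₜ[k]
        tpow k A q
          (Fin.cases
            (rho (HopfAlgebra.antipode (R := k)
                ((List.ofFn (fun i : Fin (p + 1) => (R i).leg (e i) 0)).prod))
              (a (Fin.last q)))
            (fun c : Fin q => a c.castSucc))

/-- Spec of the vertical face `δᵢ` (`0 ≤ i < Q`) on `H^{⊗(p+1)} ⊗ A^{⊗(Q+1)}`
(here `Q = q+1`): `δᵢ(g | a₀,…,a_Q) = (g | a₀,…,aᵢa_{i+1},…,a_Q)`. -/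
def IsVerFace (p q : ℕ) (i : Fin (q + 1))
    (D : ((Tpow k H p : Type) ⊗[k] (Tpow k A (q + 1) : Type)) →ₗ[k]
      ((Tpow k H p : Type) ⊗[k] (Tpow k A q : Type))) : Prop :=
  ∀ (g : Fin (p + 1) → H) (a : Fin (q + 2) → A),
    D (tpow k H p g ⊗ₜ[k] tpow k A (q + 1) a) =
      tpow k H p g ⊗ₜ[k] tpow k A q (mergeAt i a (a i.castSucc * a i.succ))

/-- Spec of the last vertical face `δ_Q` on `H^{⊗(p+1)} ⊗ A^{⊗(Q+1)}` (here `Q = q+1`):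
`δ_Q(g₀,…,g_p | a₀,…,a_Q) = (g₀⁽²⁾,…,g_p⁽²⁾ | S(g₀⁽¹⁾⋯g_p⁽¹⁾)(a_Q)a₀, a₁,…,a_{Q−1})`. -/
def IsLastVerFace (p q : ℕ)
    (D : ((Tpow k H p : Type) ⊗[k] (Tpow k A (q + 1) : Type)) →ₗ[k]
      ((Tpow k H p : Type) ⊗[k] (Tpow k A q : Type))) : Prop :=
  ∀ (g : Fin (p + 1) → H) (a : Fin (q + 2) → A)
    (R : ∀ i : Fin (p + 1), IterRepr k H 1 (g i)),
    D (tpow k H p g ⊗ₜ[k] tpow k A (q + 1) a) =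
      ∑ e ∈ Fintype.piFinset (fun i => (R i).s),
        tpow k H p (fun i => (R i).leg (e i) 1) ⊗ₜ[k]
        tpow k A q
          (Fin.cases
            (rho (HopfAlgebra.antipode (R := k)
                ((List.ofFn (fun i : Fin (p + 1) => (R i).leg (e i) 0)).prod))
              (a (Fin.last (q + 1))) * a 0)
            (fun c : Fin q => a c.succ.castSucc))

/-! ## Elementary tensors -/

theorem tpow_linearMap_ext {k : Type} [Field k] {V : Type} [AddCommGroup V] [Module k V] :
    ∀ {n : ℕ} {M : Type} [AddCommGroup M] [Module k M] {L L' : (Tpow k V n : Type) →ₗ[k] M},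
      (∀ f, L (tpow k V n f) = L' (tpow k V n f)) → L = L'
  | 0, _, _, _, _, _, h => LinearMap.ext fun v => h fun _ => v
  | n + 1, M, _, _, L, L', h => by
    refine TensorProduct.ext (LinearMap.ext fun v => tpow_linearMap_ext fun f => ?_)
    exact h (Fin.cons v f)

/-- An elementary tensor depends linearly on each of its entries. -/
theorem exists_linearMap_tpow_update {k : Type} [Field k] {V : Type} [AddCommGroup V]
    [Module k V] : ∀ {n : ℕ} (f : Fin (n + 1) → V) (i : Fin (n + 1)),
      ∃ L : V →ₗ[k] (Tpow k V n : Type), ∀ v, L v = tpow k V n (Function.update f i v)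
  | 0, f, i => by
    refine ⟨LinearMap.id, fun v => ?_⟩
    obtain rfl : i = 0 := Subsingleton.elim (α := Fin 1) _ _
    exact (Function.update_self (0 : Fin 1) v f).symm
  | n + 1, f, i => by
    refine Fin.cases ?_ (fun j => ?_) i
    · refine ⟨(TensorProduct.mk k V (Tpow k V n)).flip (tpow k V n fun i => f i.succ),
        fun v => ?_⟩
      simp only [tpow, Function.update_self, ne_eq, Fin.succ_ne_zero, not_false_eq_true,
        Function.update_of_ne]
      rfl
    · obtain ⟨L, hL⟩ := exists_linearMap_tpow_update (k := k) (fun i => f i.succ) j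
      refine ⟨TensorProduct.mk k V (Tpow k V n) (f 0) ∘ₗ L, fun v => ?_⟩
      have h : (fun i => Function.update f j.succ v (Fin.succ i)) =
          Function.update (fun i => f i.succ) j v := by
        ext c
        simp [Function.update_apply]
      simp only [tpow, h, ← hL, ne_eq, (Fin.succ_ne_zero j).symm, not_false_eq_true,
        Function.update_of_ne]
      rfl

theorem tpow_update_smul {k : Type} [Field k] {V : Type} [AddCommGroup V] [Module k V]
    {n : ℕ} (f : Fin (n + 1) → V) (i : Fin (n + 1)) (c : k) :
    tpow k V n (Function.update f i (c • f i)) = c • tpow k V n f := by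
  obtain ⟨L, hL⟩ := exists_linearMap_tpow_update (k := k) f i
  rw [← hL, map_smul, hL, Function.update_eq_self]

/-! ## Merging entries -/

theorem mergeAt_eq_update {V : Type} {n : ℕ} (i : Fin n) (x : Fin (n + 1) → V) (u v : V) :
    mergeAt i x v = Function.update (mergeAt i x u) i v := by
  ext j
  simp only [mergeAt, Function.update_apply, Fin.ext_iff]
  split_ifs <;> first | rfl | omega

theorem exists_linearMap_tpow_mergeAt {k : Type} [Field k] {V : Type} [AddCommGroup V]
    [Module k V] {n : ℕ} (i : Fin (n + 1)) (x : Fin (n + 2) → V) :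
    ∃ L : V →ₗ[k] (Tpow k V n : Type), ∀ v, L v = tpow k V n (mergeAt i x v) := by
  obtain ⟨L, hL⟩ := exists_linearMap_tpow_update (k := k) (mergeAt i x 0) i
  exact ⟨L, fun v => by rw [hL, ← mergeAt_eq_update]⟩

theorem mergeAt_mergeAt {V : Type} {n : ℕ} (i : Fin n) (x : Fin (n + 2) → V) (u v w : V) :
    mergeAt i (mergeAt i.succ x u) w = mergeAt i (mergeAt i.castSucc x v) w := by
  ext j
  simp only [mergeAt, Fin.val_succ, Fin.val_castSucc]
  split_ifs <;> first | rfl | omega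

/-! ## Sweedler sums -/

section Sweedler

variable {k : Type} [Field k] {H : Type} [Ring H] [HopfAlgebra k H]

theorem IterRepr.sum_tmul_eq_comul {h : H} (R : IterRepr k H 1 h) :
    ∑ r ∈ R.s, R.leg r 0 ⊗ₜ[k] R.leg r 1 = Coalgebra.comul (R := k) h := by
  exact R.eq.trans (LinearMap.lTensor_id_apply H H _)

/-- A Sweedler representation built from an expression of `Δ h` as a sum of pure tensors. -/
def IterRepr.ofSum {h : H} {ι : Type} (s : Finset ι) (x y : ι → H)
    (e : ∑ i ∈ s, x i ⊗ₜ[k] y i = Coalgebra.comul (R := k) h) : IterRepr k H 1 h where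
  ι := ι
  s := s
  leg i := ![x i, y i]
  eq := by
    exact e.trans (LinearMap.lTensor_id_apply H H _).symm

/-- An arbitrary Sweedler representation of `Δ h`. -/
def IterRepr.arbitrary (k : Type) [Field k] {H : Type} [Ring H] [HopfAlgebra k H] (h : H) :
    IterRepr k H 1 h :=
  let R := Coalgebra.Repr.arbitrary k h
  IterRepr.ofSum R.index R.left R.right R.eq

/-- Comultiplication is multiplicative: representations of `Δ h` and `Δ l` multiply to one
of `Δ (h * l)`. -/
def IterRepr.mul {h l : H} (R : IterRepr k H 1 h) (S : IterRepr k H 1 l) :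
    IterRepr k H 1 (h * l) :=
  IterRepr.ofSum (R.s ×ˢ S.s) (fun e => R.leg e.1 0 * S.leg e.2 0)
    (fun e => R.leg e.1 1 * S.leg e.2 1) (by
      rw [Bialgebra.comul_mul, ← R.sum_tmul_eq_comul, ← S.sum_tmul_eq_comul,
        Finset.sum_mul_sum, Finset.sum_product]
      simp)

/-- Coassociativity combined with cocommutativity:
`α(h⁽²⁾)β(h⁽¹⁾⁽²⁾)φ(h⁽¹⁾⁽¹⁾) = α(h⁽²⁾⁽¹⁾)β(h⁽²⁾⁽²⁾)φ(h⁽¹⁾)`. -/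
theorem Cocomm.sum_smul_coassoc (hco : Cocomm k H) {M : Type} [AddCommGroup M] [Module k M]
    {h : H} (R : IterRepr k H 1 h) (S : ∀ x : H, IterRepr k H 1 x)
    (α β : H →ₗ[k] k) (φ : H →ₗ[k] M) :
    ∑ r ∈ R.s, ∑ s ∈ (S (R.leg r 0)).s,
        (α (R.leg r 1) * β ((S (R.leg r 0)).leg s 1)) • φ ((S (R.leg r 0)).leg s 0) =
      ∑ r ∈ R.s, ∑ s ∈ (S (R.leg r 1)).s,
        (α ((S (R.leg r 1)).leg s 0) * β ((S (R.leg r 1)).leg s 1)) • φ (R.leg r 0) := by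
  let F : H ⊗[k] (H ⊗[k] H) →ₗ[k] M :=
    TensorProduct.lift ((LinearMap.lsmul k M).flip ∘ₗ φ) ∘ₗ
      LinearMap.lTensor H (TensorProduct.lift ((LinearMap.mul k k).compl₁₂ β α))
  have hF : ∀ x y z, F (x ⊗ₜ (y ⊗ₜ z)) = (β y * α z) • φ x := fun x y z => by simp [F]
  have hl : ∀ r, ∑ s ∈ (S (R.leg r 0)).s,
      (α (R.leg r 1) * β ((S (R.leg r 0)).leg s 1)) • φ ((S (R.leg r 0)).leg s 0) =
      F (TensorProduct.assoc k H H H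
        (Coalgebra.comul (R := k) (R.leg r 0) ⊗ₜ[k] R.leg r 1)) := fun r => by
    simp [← (S (R.leg r 0)).sum_tmul_eq_comul, TensorProduct.sum_tmul, hF, mul_comm]
  have hr : ∀ r, ∑ s ∈ (S (R.leg r 1)).s,
      (α ((S (R.leg r 1)).leg s 0) * β ((S (R.leg r 1)).leg s 1)) • φ (R.leg r 0) =
      F (R.leg r 0 ⊗ₜ[k] Coalgebra.comul (R := k) (R.leg r 1)) := fun r => by
    rw [← hco (R.leg r 1)]
    simp [← (S (R.leg r 1)).sum_tmul_eq_comul, TensorProduct.tmul_sum, hF, mul_comm]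
  have key := congrArg F (Coalgebra.coassoc_apply (R := k) h)
  rw [← R.sum_tmul_eq_comul] at key
  simp only [hl, hr]
  simpa using key

/-- `Cocomm.sum_smul_coassoc` for two elements at once. -/
theorem Cocomm.sum_smul_coassoc₂ (hco : Cocomm k H) {M : Type} [AddCommGroup M] [Module k M]
    {h l : H} (Rh : IterRepr k H 1 h) (Rl : IterRepr k H 1 l)
    (S : ∀ x : H, IterRepr k H 1 x) (α β : H →ₗ[k] H →ₗ[k] k) (φ : H →ₗ[k] H →ₗ[k] M) :
    ∑ r ∈ Rh.s, ∑ s ∈ Rl.s,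
        ∑ u ∈ (S (Rh.leg r 0)).s, ∑ v ∈ (S (Rl.leg s 0)).s,
          (α (Rh.leg r 1) (Rl.leg s 1) *
            β ((S (Rh.leg r 0)).leg u 1) ((S (Rl.leg s 0)).leg v 1)) •
          φ ((S (Rh.leg r 0)).leg u 0) ((S (Rl.leg s 0)).leg v 0) =
      ∑ r ∈ Rh.s, ∑ s ∈ Rl.s,
        (∑ u ∈ (S (Rh.leg r 1)).s, ∑ v ∈ (S (Rl.leg s 1)).s,
          α ((S (Rh.leg r 1)).leg u 0) ((S (Rl.leg s 1)).leg v 0) *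
            β ((S (Rh.leg r 1)).leg u 1) ((S (Rl.leg s 1)).leg v 1)) •
          φ (Rh.leg r 0) (Rl.leg s 0) := by
  calc
    _ = ∑ r ∈ Rh.s, ∑ u ∈ (S (Rh.leg r 0)).s,
        ∑ s ∈ Rl.s, ∑ v ∈ (S (Rl.leg s 1)).s,
          (α (Rh.leg r 1) ((S (Rl.leg s 1)).leg v 0) *
            β ((S (Rh.leg r 0)).leg u 1) ((S (Rl.leg s 1)).leg v 1)) •
          φ ((S (Rh.leg r 0)).leg u 0) (Rl.leg s 0) := by
      refine Finset.sum_congr rfl fun r _ => ?_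
      rw [Finset.sum_comm]
      exact Finset.sum_congr rfl fun u _ => hco.sum_smul_coassoc Rl S _ _ _
    _ = ∑ s ∈ Rl.s, ∑ v ∈ (S (Rl.leg s 1)).s,
        ∑ r ∈ Rh.s, ∑ u ∈ (S (Rh.leg r 0)).s,
          (α.flip ((S (Rl.leg s 1)).leg v 0) (Rh.leg r 1) *
            β.flip ((S (Rl.leg s 1)).leg v 1) ((S (Rh.leg r 0)).leg u 1)) •
          φ.flip (Rl.leg s 0) ((S (Rh.leg r 0)).leg u 0) := by
      simp only [LinearMap.flip_apply]
      rw [Finset.sum_sigma' Rh.s, Finset.sum_sigma' Rl.s]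
      conv_lhs => enter [2, x]; rw [Finset.sum_sigma' Rl.s]
      conv_rhs => enter [2, x]; rw [Finset.sum_sigma' Rh.s]
      exact Finset.sum_comm
    _ = ∑ s ∈ Rl.s, ∑ v ∈ (S (Rl.leg s 1)).s,
        ∑ r ∈ Rh.s, ∑ u ∈ (S (Rh.leg r 1)).s,
          (α.flip ((S (Rl.leg s 1)).leg v 0) ((S (Rh.leg r 1)).leg u 0) *
            β.flip ((S (Rl.leg s 1)).leg v 1) ((S (Rh.leg r 1)).leg u 1)) •
          φ.flip (Rl.leg s 0) (Rh.leg r 0) :=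
      Finset.sum_congr rfl fun s _ => Finset.sum_congr rfl fun v _ =>
        hco.sum_smul_coassoc Rh S _ _ _
    _ = _ := by
      simp only [Finset.sum_smul, LinearMap.flip_apply]
      rw [Finset.sum_comm (s := Rh.s)]
      refine Finset.sum_congr rfl fun s _ => ?_
      rw [Finset.sum_comm]
      exact Finset.sum_congr rfl fun r _ => Finset.sum_comm

end Sweedler

/-! ## Horizontal faces -/

section Face

variable {k : Type} [Field k] {H : Type} [Ring H] [HopfAlgebra k H]
  {A : Type} [Ring A] [Algebra k A] {sg : H →ₗ[k] H →ₗ[k] k}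

theorem IsHorFace.apply_tmul {p q : ℕ} {i : Fin (p + 1)}
    {D : ((Tpow k H (p + 1) : Type) ⊗[k] (Tpow k A q : Type)) →ₗ[k]
      ((Tpow k H p : Type) ⊗[k] (Tpow k A q : Type))} (hD : IsHorFace k H A sg p q i D)
    (g : Fin (p + 2) → H) (a : Fin (q + 1) → A) {h l : H} (hh : g i.castSucc = h)
    (hl : g i.succ = l) (R : IterRepr k H 1 h) (S : IterRepr k H 1 l) :
    D (tpow k H (p + 1) g ⊗ₜ[k] tpow k A q a) =
      ∑ r ∈ R.s, ∑ s ∈ S.s, sg (R.leg r 1) (S.leg s 1) •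
        (tpow k H p (mergeAt i g (R.leg r 0 * S.leg s 0)) ⊗ₜ[k] tpow k A q a) := by
  subst hh hl
  simp only [hD g a R S, tpow_update_smul, TensorProduct.tmul_smul]

/-- The cocycle identity propagated along the multiplication of three factors: both sides are
`h⁽¹⁾l⁽¹⁾m⁽¹⁾` weighted by the two sides of the cocycle identity in the remaining legs. -/
theorem CocycleK.sum_smul_mul_mul (hcoc : CocycleK k H sg) (hco : Cocomm k H)
    (R : ∀ x : H, IterRepr k H 1 x) (h l m : H) :
    ∑ r ∈ (R h).s, ∑ s ∈ (R l).s, ∑ t ∈ (R m).s,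
      ∑ u ∈ (R ((R l).leg s 0)).s, ∑ v ∈ (R ((R m).leg t 0)).s,
        (sg ((R l).leg s 1) ((R m).leg t 1) *
          sg ((R h).leg r 1) ((R ((R l).leg s 0)).leg u 1 * (R ((R m).leg t 0)).leg v 1)) •
        ((R h).leg r 0 * ((R ((R l).leg s 0)).leg u 0 * (R ((R m).leg t 0)).leg v 0)) =
    ∑ t ∈ (R m).s, ∑ r ∈ (R h).s, ∑ s ∈ (R l).s,
      ∑ u ∈ (R ((R h).leg r 0)).s, ∑ v ∈ (R ((R l).leg s 0)).s,
        (sg ((R h).leg r 1) ((R l).leg s 1) *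
          sg ((R ((R h).leg r 0)).leg u 1 * (R ((R l).leg s 0)).leg v 1) ((R m).leg t 1)) •
        ((R ((R h).leg r 0)).leg u 0 * (R ((R l).leg s 0)).leg v 0 * (R m).leg t 0) := by
  have hl := fun r => hco.sum_smul_coassoc₂ (R l) (R m) R sg
    ((LinearMap.mul k H).compr₂ (sg ((R h).leg r 1)))
    ((LinearMap.mul k H).compr₂ (LinearMap.mulLeft k ((R h).leg r 0)))
  have hr := fun t => hco.sum_smul_coassoc₂ (R h) (R l) R sg
    ((LinearMap.mul k H).compr₂ (sg.flip ((R m).leg t 1)))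
    ((LinearMap.mul k H).compr₂ (LinearMap.mulRight k ((R m).leg t 0)))
  simp only [LinearMap.compr₂_apply, LinearMap.mul_apply', LinearMap.mulLeft_apply,
    LinearMap.mulRight_apply, LinearMap.flip_apply] at hl hr
  simp only [hl, hr, hcoc _ _ _ (R _) (R _) (R _)]
  simp only [mul_assoc]
  rw [Finset.sum_comm (s := (R m).s)]
  exact Finset.sum_congr rfl fun r _ => Finset.sum_comm

end Face

/-- Under the standing assumptions, the horizontal face operators of
`A ♮_σ H` satisfy `dᵢ ∘ d_{i+1} = dᵢ ∘ dᵢ` for `0 ≤ i ≤ P − 2` (here with `P = p + 2` and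
`i : Fin (p+1)`, on `H^{⊗(p+3)} ⊗ A^{⊗(q+1)}`). -/
theorem horFace_comp_relation
    (k : Type) [Field k] (H : Type) [Ring H] [HopfAlgebra k H]
    (A : Type) [Ring A] [Algebra k A]
    (rho : H →ₗ[k] A →ₗ[k] A) (sg : H →ₗ[k] H →ₗ[k] k)
    (hco : Cocomm k H) (hma : IsModuleAlgebraAction k H A rho)
    (hnorm : NormalKA k H A sg) (hcoc : CocycleKA k H A sg)
    (htw : TwistedModuleK k H A rho sg) (hinv : ConvInvertibleK k H A sg)
    (p q : ℕ) (i : Fin (p + 1))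
    (Dout : ((Tpow k H (p + 1) : Type) ⊗[k] (Tpow k A q : Type)) →ₗ[k]
      ((Tpow k H p : Type) ⊗[k] (Tpow k A q : Type)))
    (Din Din1 : ((Tpow k H (p + 2) : Type) ⊗[k] (Tpow k A q : Type)) →ₗ[k]
      ((Tpow k H (p + 1) : Type) ⊗[k] (Tpow k A q : Type)))
    (hDout : IsHorFace k H A sg p q i Dout)
    (hDin : IsHorFace k H A sg (p + 1) q i.castSucc Din)
    (hDin1 : IsHorFace k H A sg (p + 1) q i.succ Din1) :
    Dout ∘ₗ Din1 = Dout ∘ₗ Din := by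
  let R := fun x : H => IterRepr.arbitrary k x
  refine TensorProduct.ext (tpow_linearMap_ext fun g => tpow_linearMap_ext fun a => ?_)
  change Dout (Din1 (_ ⊗ₜ[k] _)) = Dout (Din (_ ⊗ₜ[k] _))
  rcases subsingleton_or_nontrivial A with hA | hA
  · have ha : tpow k A q a = 0 := by
      have h0 := tpow_update_smul (k := k) a 0 0
      rwa [Function.update_eq_self_iff.2 (Subsingleton.elim _ _), zero_smul k] at h0
    simp only [ha, TensorProduct.tmul_zero, map_zero]
  have hcocK : CocycleK k H sg := fun h l m Rh Rl Rm => by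
    have := hcoc h l m Rh Rl Rm
    simp only [← Finset.sum_smul] at this
    exact smul_left_injective k one_ne_zero this
  have key := hcocK.sum_smul_mul_mul hco R (g i.castSucc.castSucc) (g i.succ.castSucc)
    (g i.succ.succ)
  obtain ⟨L, hL⟩ := exists_linearMap_tpow_mergeAt (k := k) i (mergeAt i.succ g 0)
  have hL₁ : ∀ u w, tpow k H p (mergeAt i (mergeAt i.succ g u) w) = L w := fun u w => by
    rw [hL, mergeAt_mergeAt i g u 0, mergeAt_mergeAt i g 0 0]
  have hL₂ : ∀ v w, tpow k H p (mergeAt i (mergeAt i.castSucc g v) w) = L w := fun v w => by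
    rw [hL, mergeAt_mergeAt i g 0 v]
  have h₁ : ∀ u, (mergeAt i.succ g u) i.castSucc = g i.castSucc.castSucc := fun u => by
    simp [mergeAt]
  have h₂ : ∀ u, (mergeAt i.succ g u) i.succ = u := fun u => by simp [mergeAt]
  have h₃ : ∀ u, (mergeAt i.castSucc g u) i.castSucc = u := fun u => by simp [mergeAt]
  have h₄ : ∀ u, (mergeAt i.castSucc g u) i.succ = g i.succ.succ := fun u => by
    simp [mergeAt]
  rw [hDin1.apply_tmul g a rfl rfl (R _) (R _),
    hDin.apply_tmul g a rfl (congrArg g (Fin.succ_castSucc i)) (R _) (R _)]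
  simp only [map_sum, map_smul,
    hDout.apply_tmul _ a (h₁ _) (h₂ _) (R _) ((R _).mul (R _)),
    hDout.apply_tmul _ a (h₃ _) (h₄ _) ((R _).mul (R _)) (R _), hL₁, hL₂]
  have tensored := congrArg (fun x => L x ⊗ₜ[k] tpow k A q a) key
  simp only [map_sum, map_smul, TensorProduct.sum_tmul, ← TensorProduct.smul_tmul'] at tensored
  simp only [IterRepr.mul, IterRepr.ofSum, Finset.sum_product, Finset.smul_sum, smul_smul,
    Matrix.cons_val_zero, Matrix.cons_val_one]
  refine Eq.trans ?_ (tensored.trans ?_)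
  · rw [Finset.sum_comm (s := (R (g i.castSucc.castSucc)).s)]
    exact Finset.sum_congr rfl fun s _ => Finset.sum_comm
  · rw [Finset.sum_comm (s := (R (g i.succ.succ)).s)]
    refine Finset.sum_congr rfl fun r _ => ?_
    rw [Finset.sum_comm (s := (R (g i.succ.succ)).s)]
    refine Finset.sum_congr rfl fun s _ => ?_
    rw [Finset.sum_comm (s := (R (g i.succ.succ)).s)]
    exact Finset.sum_congr rfl fun u _ => Finset.sum_comm
end
end

section
/- Under the standing assumptions, for all p ≥ 1 and q ≥ 0, the operators on H^{⊗(p+1)}⊗A^{⊗(q+1)} satisfy d_0 ∘ t = d_p, where t(g_0,…,g_p | a_0,…,a_q) = (g_p^{(q+2)}, g_0,…,g_{p−1} | g_p⁽¹⁾(a_0),…,g_p^{(q+1)}(a_q)), d_0(g_0,…,g_p | a_0,…,a_q) = (g_0⁽¹⁾g_1⁽¹⁾, g_2,…,g_p | σ(g_0⁽²⁾,g_1⁽²⁾)a_0, a_1,…,a_q), and d_p(g_0,…,g_p | a_0,…,a_q) = (g_p^{(q+2)}g_0⁽¹⁾, g_1,…,g_{p−1} | σ(g_p^{(q+3)},g_0⁽²⁾)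 g_p⁽¹⁾(a_0),…, g_p^{(q+1)}(a_q)). -/
open TensorProduct

noncomputable section

variable (k : Type) [Field k] (H : Type) [Ring H] [HopfAlgebra k H]

variable (A : Type) [Ring A] [Algebra k A]
variable (rho : H →ₗ[k] A →ₗ[k] A)

variable (sg : H →ₗ[k] H →ₗ[k] k)

theorem Tpow.exists_sum_tpow (k : Type) [Field k] (V : Type) [AddCommGroup V] [Module k V] :
    ∀ (n : ℕ) (x : Tpow k V n), ∃ (ι : Type) (s : Finset ι) (f : ι → Fin (n + 1) → V),
      ∑ i ∈ s, tpow k V n (f i) = x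
  | 0, x => ⟨Unit, {()}, fun _ _ => x, by simp [tpow]⟩
  | n + 1, x => by
    change V ⊗[k] Tpow k V n at x
    induction x using TensorProduct.induction_on with
    | zero => exact ⟨Empty, ∅, fun e => e.elim, rfl⟩
    | tmul v y =>
      obtain ⟨ι, s, f, rfl⟩ := Tpow.exists_sum_tpow k V n y
      exact ⟨ι, s, fun i => Fin.cons v (f i), (TensorProduct.tmul_sum v s _).symm⟩
    | add x y hx hy =>
      obtain ⟨ι, s, f, rfl⟩ := hx
      obtain ⟨κ, t, g, rfl⟩ := hy
      refine ⟨ι ⊕ κ, s.disjSum t, Sum.elim f g, ?_⟩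
      rw [Finset.sum_disjSum]
      rfl

/-- Linear maps out of a tensor product of two tensor powers are determined by their values on
elementary tensors. -/
theorem Tpow.linearMap_ext (k : Type) [Field k] {V W M : Type} [AddCommGroup V] [Module k V]
    [AddCommGroup W] [Module k W] [AddCommGroup M] [Module k M] {m n : ℕ}
    {F G : ((Tpow k V m : Type) ⊗[k] (Tpow k W n : Type)) →ₗ[k] M}
    (h : ∀ f g, F (tpow k V m f ⊗ₜ[k] tpow k W n g) = G (tpow k V m f ⊗ₜ[k] tpow k W n g)) :
    F = G := by
  refine TensorProduct.ext' fun x y => ?_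
  obtain ⟨ι, s, f, rfl⟩ := Tpow.exists_sum_tpow k V m x
  obtain ⟨κ, t, g, rfl⟩ := Tpow.exists_sum_tpow k W n y
  simp only [TensorProduct.sum_tmul, TensorProduct.tmul_sum, map_sum, h]

theorem IterRepr.nonempty (k : Type) [Field k] (H : Type) [Ring H] [HopfAlgebra k H]
    (n : ℕ) (h : H) : Nonempty (IterRepr k H n h) := by
  obtain ⟨ι, s, f, hf⟩ := Tpow.exists_sum_tpow k H n (comulIter k H n h)
  exact ⟨⟨ι, s, f, hf⟩⟩

/-- Apply the comultiplication to the last factor of `H^{⊗(n+1)}`. -/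
def comulLast (k : Type) [Field k] (H : Type) [Ring H] [HopfAlgebra k H] :
    (n : ℕ) → Tpow k H n →ₗ[k] Tpow k H (n + 1)
  | 0 => (Coalgebra.comul : H →ₗ[k] H ⊗[k] H)
  | n + 1 => (LinearMap.lTensor H (comulLast k H n) :
      (H ⊗[k] Tpow k H n) →ₗ[k] (H ⊗[k] Tpow k H (n + 1)))

theorem comulLast_comulIter (k : Type) [Field k] (H : Type) [Ring H] [HopfAlgebra k H] :
    ∀ (n : ℕ) (h : H), comulLast k H n (comulIter k H n h) = comulIter k H (n + 1) h
  | 0, h => by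
    change Coalgebra.comul (R := k) h =
      LinearMap.lTensor H (LinearMap.id : H →ₗ[k] H) (Coalgebra.comul (R := k) h)
    rw [LinearMap.lTensor_id, LinearMap.id_apply]
  | n + 1, h => by
    change LinearMap.lTensor H (comulLast k H n)
        (LinearMap.lTensor H (comulIter k H n) (Coalgebra.comul (R := k) h)) =
      LinearMap.lTensor H (comulIter k H (n + 1)) (Coalgebra.comul (R := k) h)
    rw [← LinearMap.comp_apply, ← LinearMap.lTensor_comp]
    congr 2
    exact LinearMap.ext (comulLast_comulIter k H n)

/-- Replace the last entry of an `(n+1)`-tuple by the two entries `x`, `y`. -/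
def splitLast {V : Type} {n : ℕ} (f : Fin (n + 1) → V) (x y : V) : Fin (n + 2) → V :=
  fun c => if h : (c : ℕ) < n then f ⟨c, by omega⟩ else if (c : ℕ) = n then x else y

theorem comulLast_tpow (k : Type) [Field k] (H : Type) [Ring H] [HopfAlgebra k H] :
    ∀ (n : ℕ) (f : Fin (n + 1) → H) (R : IterRepr k H 1 (f (Fin.last n))),
      comulLast k H n (tpow k H n f) =
        ∑ j ∈ R.s, tpow k H (n + 1) (splitLast f (R.leg j 0) (R.leg j 1))
  | 0, f, R => by
    refine (comulLast_comulIter k H 0 (f 0)).trans (R.eq.symm.trans ?_)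
    refine Finset.sum_congr rfl fun j _ => congrArg _ ?_
    funext c
    fin_cases c <;> rfl
  | n + 1, f, R => by
    refine (LinearMap.lTensor_tmul H (comulLast k H n) (f 0) _).trans ?_
    rw [comulLast_tpow k H n (fun i => f i.succ) R, TensorProduct.tmul_sum]
    refine Finset.sum_congr rfl fun j _ => ?_
    have h0 : splitLast f (R.leg j 0) (R.leg j 1) 0 = f 0 := by simp [splitLast]
    have hs : (fun i : Fin (n + 2) => splitLast f (R.leg j 0) (R.leg j 1) i.succ) =
        splitLast (fun i => f i.succ) (R.leg j 0) (R.leg j 1) := by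
      funext i
      simp [splitLast]
    change _ = splitLast f (R.leg j 0) (R.leg j 1) 0 ⊗ₜ[k]
      tpow k H (n + 1) (fun i => splitLast f (R.leg j 0) (R.leg j 1) i.succ)
    rw [h0, hs]

/-- Refine a Sweedler representation by expanding the last leg of every summand. -/
def IterRepr.split {k : Type} [Field k] {H : Type} [Ring H] [HopfAlgebra k H] {n : ℕ} {h : H}
    (R : IterRepr k H n h) (L : ∀ r, IterRepr k H 1 (R.leg r (Fin.last n))) :
    IterRepr k H (n + 1) h where
  ι := Σ r, (L r).ι
  s := R.s.sigma fun r => (L r).s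
  leg i := splitLast (R.leg i.1) ((L i.1).leg i.2 0) ((L i.1).leg i.2 1)
  eq := by
    rw [Finset.sum_sigma, ← comulLast_comulIter, ← R.eq, map_sum]
    exact Finset.sum_congr rfl fun r _ => (comulLast_tpow k H n (R.leg r) (L r)).symm

/-- Under the standing assumptions, on `H^{⊗(p+2)} ⊗ A^{⊗(q+1)}` (i.e. for
`P = p + 1 ≥ 1` factors-index) one has `d₀ ∘ t = d_P`. -/
theorem face_zero_comp_cyclic_eq_lastFace
    (k : Type) [Field k] (H : Type) [Ring H] [HopfAlgebra k H]
    (A : Type) [Ring A] [Algebra k A]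
    (rho : H →ₗ[k] A →ₗ[k] A) (sg : H →ₗ[k] H →ₗ[k] k)
    (hco : Cocomm k H) (hma : IsModuleAlgebraAction k H A rho)
    (hnorm : NormalKA k H A sg) (hcoc : CocycleKA k H A sg)
    (htw : TwistedModuleK k H A rho sg) (hinv : ConvInvertibleK k H A sg)
    (p q : ℕ)
    (T : ((Tpow k H (p + 1) : Type) ⊗[k] (Tpow k A q : Type)) →ₗ[k]
      ((Tpow k H (p + 1) : Type) ⊗[k] (Tpow k A q : Type)))
    (D0 Dlast : ((Tpow k H (p + 1) : Type) ⊗[k] (Tpow k A q : Type)) →ₗ[k]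
      ((Tpow k H p : Type) ⊗[k] (Tpow k A q : Type)))
    (hT : IsCycT k H A rho (p + 1) q T)
    (hD0 : IsHorFace k H A sg p q 0 D0)
    (hDlast : IsLastHorFace k H A rho sg p q Dlast) :
    D0 ∘ₗ T = Dlast := by
  refine Tpow.linearMap_ext k fun g a => ?_
  let R := (IterRepr.nonempty k H (q + 1) (g (Fin.last (p + 1)))).some
  let S := (IterRepr.nonempty k H 1 (g 0)).some
  let L : ∀ r, IterRepr k H 1 (R.leg r (Fin.last (q + 1))) :=
    fun r => (IterRepr.nonempty k H 1 _).some
  rw [LinearMap.comp_apply, hT g a R, hDlast g a (R.split L) S, map_sum]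
  refine Eq.trans ?_ (Finset.sum_sigma R.s (fun r => (L r).s) _).symm
  refine Finset.sum_congr rfl fun r _ => ?_
  rw [hD0 _ _ (L r) S]
  refine Finset.sum_congr rfl fun j _ => Finset.sum_congr rfl fun s _ => ?_
  congr 2
  · funext c
    refine Fin.cases ?_ (fun c => ?_) c <;> simp [mergeAt, IterRepr.split, splitLast]
  · funext c
    refine Fin.cases ?_ (fun c => ?_) c
    · simp [IterRepr.split, splitLast]
    · simp [IterRepr.split, splitLast]
      rfl
end
end
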